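/- arXiv:2404.02246 — 2 statements merged into one kernel-verified Lean document; each statement's English description precedes it below -/
import Mathlib

section
/- Let (Ω, 𝒜, μ) be a measure space, let W : Ω → P_d(ℂ) be an 𝒜-measurable function taking values in the positive definite d×d complex matrices, and let F : Ω → 𝒦_bcs(ℂ^d) be a weakly 𝒜-measurable map. Then there exists an 𝒜-measurable function h : Ω → ℂ^d with h(ω) ∈ F(ω) for every ω ∈ Ω and |W(ω)·h(ω)| = |W(ω)·F(ω)| for μ-a.e. ω ∈ Ω, where |W(ω)·F(ω)| := sup{|W(ω)·v| : v ∈ F(ω)}. In particular (taking W ≡ Id), there exists an 𝒜-measurable selection h of F with |h(ω)| = |F(ω)| for μ-a.e. ω ∈ Ω. -/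
open MeasureTheory ENNReal
open scoped ComplexOrder Pointwise

noncomputable section


/-- A set-valued map `F` is weakly `𝒜`-measurable if `{ω | F ω ∩ U ≠ ∅}` is measurable
for every open `U`. -/
def WeaklyMeasurable {Ω X : Type*} [MeasurableSpace Ω] [TopologicalSpace X]
    (F : Ω → Set X) : Prop :=
  ∀ U : Set X, IsOpen U → MeasurableSet {ω | (F ω ∩ U).Nonempty}

/-- A convex body around `0` in `ℂ^d`: a nonempty, convex, closed, bounded and
complex-symmetric set. -/
def KBCS {d : ℕ} (K : Set (EuclideanSpace ℂ (Fin d))) : Prop :=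
  K.Nonempty ∧ Convex ℝ K ∧ IsClosed K ∧ Bornology.IsBounded K ∧
    ∀ c : ℂ, ‖c‖ = 1 → ∀ x ∈ K, c • x ∈ K

/-- `|K| = sup {|a| : a ∈ K}`, for a bounded nonempty `K`. -/
def setNorm {d : ℕ} (K : Set (EuclideanSpace ℂ (Fin d))) : ℝ :=
  sSup ((fun x => ‖x‖) '' K)

/-- Equip `ℂ^d` (as a Euclidean space) with its Borel σ-algebra. -/
instance euclideanComplexMeasurableSpace {d : ℕ} :
    MeasurableSpace (EuclideanSpace ℂ (Fin d)) := borel _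

instance euclideanComplexBorelSpace {d : ℕ} :
    BorelSpace (EuclideanSpace ℂ (Fin d)) := ⟨rfl⟩

section MeasurableMaximum

variable {Ω E : Type*} [MeasurableSpace Ω]

/-- The set of maximizers of `f` over `K`. -/
def maximizerSet (f : E → ℝ) (K : Set E) : Set E :=
  {x ∈ K | IsMaxOn f K x}

theorem IsCompact.maximizers [TopologicalSpace E] {f : E → ℝ} {K : Set E} (hK : IsCompact K)
    (hf : Continuous f) : IsCompact (maximizerSet f K) := by
  have : maximizerSet f K = K ∩ ⋂ y ∈ K, {x | f y ≤ f x} := by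
    ext x
    simp [maximizerSet, isMaxOn_iff]
  rw [this]
  exact hK.inter_right
    (isClosed_biInter fun y _ => isClosed_le continuous_const hf)

theorem IsCompact.maximizers_nonempty [TopologicalSpace E] {f : E → ℝ} {K : Set E}
    (hK : IsCompact K) (hne : K.Nonempty) (hf : Continuous f) : (maximizerSet f K).Nonempty :=
  hK.exists_isMaxOn hne hf.continuousOn

theorem WeaklyMeasurable.measurableSet_exists_lt [TopologicalSpace E] [SecondCountableTopology E]
    {F : Ω → Set E} (hF : WeaklyMeasurable F) {φ : Ω → E → ℝ}
    (hφm : ∀ x, Measurable fun ω => φ ω x) (hφc : ∀ ω, Continuous (φ ω))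
    {U : Set E} (hU : IsOpen U) (q : ℝ) :
    MeasurableSet {ω | ∃ x ∈ F ω, x ∈ U ∧ q < φ ω x} := by
  obtain ⟨D, hDc, hD⟩ := TopologicalSpace.exists_countable_dense E
  have key : {ω | ∃ x ∈ F ω, x ∈ U ∧ q < φ ω x} =
      ⋃ B ∈ TopologicalSpace.countableBasis E, ⋃ r : ℚ, ⋃ _ : q < r,
        {ω | (F ω ∩ (B ∩ U)).Nonempty} ∩ ⋂ y ∈ D ∩ B, {ω | (r : ℝ) ≤ φ ω y} := by
    ext ω
    simp only [Set.mem_ofPred_eq, Set.mem_iUnion, Set.mem_inter_iff, Set.mem_iInter, exists_prop]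
    constructor
    · rintro ⟨x, hxF, hxU, hqx⟩
      obtain ⟨r, hqr, hrx⟩ := exists_rat_btwn hqx
      obtain ⟨B, hB, hxB, hBs⟩ :=
        (TopologicalSpace.isBasis_countableBasis E).exists_subset_of_mem_open
          (show x ∈ {z | (r : ℝ) < φ ω z} from hrx) (isOpen_lt continuous_const (hφc ω))
      exact ⟨B, hB, r, hqr, ⟨x, hxF, hxB, hxU⟩, fun y hy => le_of_lt (hBs hy.2)⟩
    · rintro ⟨B, hB, r, hqr, ⟨x, hxF, hxB, hxU⟩, hy⟩
      have hBo := TopologicalSpace.isOpen_of_mem_countableBasis hB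
      have hx : x ∈ closure (B ∩ D) := hD.open_subset_closure_inter hBo hxB
      have hsub : B ∩ D ⊆ {z | (r : ℝ) ≤ φ ω z} := fun y hyB => hy y ⟨hyB.2, hyB.1⟩
      exact ⟨x, hxF, hxU, hqr.trans_le
        (closure_minimal hsub (isClosed_le continuous_const (hφc ω)) hx)⟩
  rw [key]
  refine MeasurableSet.biUnion (TopologicalSpace.countable_countableBasis E) fun B hB =>
    MeasurableSet.iUnion fun r => MeasurableSet.iUnion fun _ => ?_
  exact (hF _ ((TopologicalSpace.isOpen_of_mem_countableBasis hB).inter hU)).inter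
    (MeasurableSet.biInter (hDc.mono Set.inter_subset_left) fun y _ =>
      measurableSet_le measurable_const (hφm y))

theorem WeaklyMeasurable.measurableSet_exists_le [PseudoMetricSpace E] [SecondCountableTopology E]
    {F : Ω → Set E} (hF : WeaklyMeasurable F) (hFc : ∀ ω, IsCompact (F ω)) {φ : Ω → E → ℝ}
    (hφm : ∀ x, Measurable fun ω => φ ω x) (hφc : ∀ ω, Continuous (φ ω))
    {C : Set E} (hC : IsClosed C) (q : ℝ) :
    MeasurableSet {ω | ∃ x ∈ F ω, x ∈ C ∧ q ≤ φ ω x} := by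
  have key : {ω | ∃ x ∈ F ω, x ∈ C ∧ q ≤ φ ω x} =
      ⋂ n : ℕ, {ω | ∃ x ∈ F ω, x ∈ Metric.thickening (1 / ((n : ℝ) + 1)) C ∧
        q - 1 / ((n : ℝ) + 1) < φ ω x} := by
    ext ω
    simp only [Set.mem_ofPred_eq, Set.mem_iInter]
    constructor
    · rintro ⟨x, hxF, hxC, hx⟩ n
      have hn : 0 < 1 / ((n : ℝ) + 1) := Nat.one_div_pos_of_nat
      exact ⟨x, hxF, Metric.self_subset_thickening hn C hxC, by linarith⟩
    · intro h
      choose x hxF hxC hx using h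
      obtain ⟨a, haF, s, hs, hlim⟩ := (hFc ω).tendsto_subseq hxF
      have h0 : Filter.Tendsto (fun n : ℕ => 1 / (((s n : ℕ) : ℝ) + 1)) Filter.atTop (nhds 0) :=
        tendsto_one_div_add_atTop_nhds_zero_nat.comp hs.tendsto_atTop
      choose y hyC hy using fun n => Metric.mem_thickening_iff.1 (hxC n)
      have hylim : Filter.Tendsto (fun n => y (s n)) Filter.atTop (nhds a) :=
        (tendsto_iff_of_dist
          (squeeze_zero (fun _ => dist_nonneg) (fun n => (hy (s n)).le) h0)).1 hlim
      refine ⟨a, haF, hC.mem_of_tendsto hylim (.of_forall fun n => hyC _), ?_⟩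
      have h1 := ((hφc ω).tendsto a).comp hlim
      have h2 : Filter.Tendsto (fun n : ℕ => q - 1 / (((s n : ℕ) : ℝ) + 1)) Filter.atTop
          (nhds q) := by simpa using h0.const_sub q
      exact le_of_tendsto_of_tendsto' h2 h1 fun n => (hx (s n)).le
  rw [key]
  exact MeasurableSet.iInter fun n =>
    hF.measurableSet_exists_lt hφm hφc Metric.isOpen_thickening _

/-- The maximizers of a Carathéodory function over a weakly measurable compact-valued map form
a weakly measurable map. -/
theorem WeaklyMeasurable.maximizers [PseudoMetricSpace E] [SecondCountableTopology E]
    {F : Ω → Set E} (hF : WeaklyMeasurable F) (hFc : ∀ ω, IsCompact (F ω))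
    (hFne : ∀ ω, (F ω).Nonempty) {φ : Ω → E → ℝ}
    (hφm : ∀ x, Measurable fun ω => φ ω x) (hφc : ∀ ω, Continuous (φ ω)) :
    WeaklyMeasurable fun ω => maximizerSet (φ ω) (F ω) := by
  have closed_case (C : Set E) (hC : IsClosed C) :
      MeasurableSet {ω | (maximizerSet (φ ω) (F ω) ∩ C).Nonempty} := by
    have key : {ω | (maximizerSet (φ ω) (F ω) ∩ C).Nonempty} =
        ⋂ q : ℚ, {ω | ∃ x ∈ F ω, x ∈ Set.univ ∧ (q : ℝ) ≤ φ ω x}ᶜ ∪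
          {ω | ∃ x ∈ F ω, x ∈ C ∧ (q : ℝ) ≤ φ ω x} := by
      ext ω
      simp only [Set.mem_ofPred_eq, Set.mem_iInter, Set.mem_union, Set.mem_compl_iff,
        ← imp_iff_not_or]
      constructor
      · rintro ⟨x, ⟨hxF, hx⟩, hxC⟩ q ⟨y, hyF, -, hy⟩
        exact ⟨x, hxF, hxC, hy.trans (hx hyF)⟩
      · intro h
        obtain ⟨y, hyF, hy⟩ := (hFc ω).exists_isMaxOn (hFne ω) (hφc ω).continuousOn
        have hne : (F ω ∩ C).Nonempty := by
          obtain ⟨q, hq⟩ := exists_rat_lt (φ ω y)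
          obtain ⟨x, hxF, hxC, -⟩ := h q ⟨y, hyF, trivial, hq.le⟩
          exact ⟨x, hxF, hxC⟩
        obtain ⟨x, hxFC, hx⟩ :=
          ((hFc ω).inter_right hC).exists_isMaxOn hne (hφc ω).continuousOn
        have hyx : φ ω y ≤ φ ω x := by
          by_contra! hlt
          obtain ⟨q, hxq, hqy⟩ := exists_rat_btwn hlt
          obtain ⟨z, hzF, hzC, hz⟩ := h q ⟨y, hyF, trivial, hqy.le⟩
          exact absurd (hz.trans (hx ⟨hzF, hzC⟩)) hxq.not_ge
        exact ⟨x, ⟨hxFC.1, fun z hz => (hy hz).trans hyx⟩, hxFC.2⟩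
    rw [key]
    exact MeasurableSet.iInter fun q =>
      (hF.measurableSet_exists_le hFc hφm hφc isClosed_univ q).compl.union
        (hF.measurableSet_exists_le hFc hφm hφc hC q)
  intro U hU
  obtain ⟨C, hC, -, hCU, -⟩ := hU.exists_iUnion_isClosed
  have : {ω | (maximizerSet (φ ω) (F ω) ∩ U).Nonempty} =
      ⋃ n, {ω | (maximizerSet (φ ω) (F ω) ∩ C n).Nonempty} := by
    ext ω
    simp [← hCU, Set.inter_iUnion]
  rw [this]
  exact MeasurableSet.iUnion fun n => closed_case _ (hC n)

/-- Successive maximization of finitely many continuous functions makes all of them constant on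
a weakly measurable compact-valued submap. -/
theorem WeaklyMeasurable.exists_submap_eq_on [PseudoMetricSpace E] [SecondCountableTopology E]
    {F : Ω → Set E} (hF : WeaklyMeasurable F) (hFc : ∀ ω, IsCompact (F ω))
    (hFne : ∀ ω, (F ω).Nonempty) {ι : Type*} (s : Finset ι) {f : ι → E → ℝ}
    (hf : ∀ i, Continuous (f i)) :
    ∃ G : Ω → Set E, WeaklyMeasurable G ∧ (∀ ω, IsCompact (G ω)) ∧ (∀ ω, (G ω).Nonempty) ∧
      (∀ ω, G ω ⊆ F ω) ∧ ∀ ω, ∀ i ∈ s, ∀ x ∈ G ω, ∀ y ∈ G ω, f i x = f i y := by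
  classical
  induction s using Finset.induction_on with
  | empty => exact ⟨F, hF, hFc, hFne, fun _ => subset_rfl, by simp⟩
  | insert j s _ ih =>
    obtain ⟨G, hG, hGc, hGne, hGF, hGs⟩ := ih
    refine ⟨fun ω => maximizerSet (f j) (G ω),
      hG.maximizers hGc hGne (fun _ => measurable_const) (fun _ => hf j),
      fun ω => (hGc ω).maximizers (hf j), fun ω => (hGc ω).maximizers_nonempty (hGne ω) (hf j),
      fun ω x hx => hGF ω hx.1, fun ω i hi x hx y hy => ?_⟩
    obtain rfl | hi := Finset.mem_insert.1 hi
    · exact le_antisymm (hy.2 hx.1) (hx.2 hy.1)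
    · exact hGs ω i hi x hx.1 y hy.1

/-- A weakly measurable compact-valued map into a finite-dimensional space has a measurable
selection. -/
theorem WeaklyMeasurable.exists_measurable_selection [NormedAddCommGroup E] [NormedSpace ℝ E]
    [FiniteDimensional ℝ E] [MeasurableSpace E] [BorelSpace E]
    {F : Ω → Set E} (hF : WeaklyMeasurable F) (hFc : ∀ ω, IsCompact (F ω))
    (hFne : ∀ ω, (F ω).Nonempty) :
    ∃ h : Ω → E, Measurable h ∧ ∀ ω, h ω ∈ F ω := by
  have := FiniteDimensional.proper_real E
  let b := Module.finBasis ℝ E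
  obtain ⟨G, hG, -, hGne, hGF, hGeq⟩ := hF.exists_submap_eq_on hFc hFne Finset.univ
    (f := fun i x => b.coord i x) fun i => (b.coord i).continuous_of_finiteDimensional
  choose h hh using hGne
  refine ⟨h, measurable_of_isOpen fun U hU => ?_, fun ω => hGF ω (hh ω)⟩
  convert hG U hU using 1
  ext ω
  refine ⟨fun hω => ⟨h ω, hh ω, hω⟩, ?_⟩
  rintro ⟨x, hxG, hxU⟩
  have : h ω = x := b.ext_elem fun i => hGeq ω i (Finset.mem_univ i) _ (hh ω) _ hxG
  rwa [Set.mem_preimage, this]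

/-- Measurable maximum theorem in a finite-dimensional space. -/
theorem WeaklyMeasurable.exists_measurable_eq_sSup [NormedAddCommGroup E] [NormedSpace ℝ E]
    [FiniteDimensional ℝ E] [MeasurableSpace E] [BorelSpace E]
    {F : Ω → Set E} (hF : WeaklyMeasurable F) (hFc : ∀ ω, IsCompact (F ω))
    (hFne : ∀ ω, (F ω).Nonempty) {φ : Ω → E → ℝ}
    (hφm : ∀ x, Measurable fun ω => φ ω x) (hφc : ∀ ω, Continuous (φ ω)) :
    ∃ h : Ω → E, Measurable h ∧ (∀ ω, h ω ∈ F ω) ∧ ∀ ω, φ ω (h ω) = sSup (φ ω '' F ω) := by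
  have := FiniteDimensional.proper_real E
  obtain ⟨h, hm, hh⟩ := (hF.maximizers hFc hFne hφm hφc).exists_measurable_selection
    (fun ω => (hFc ω).maximizers (hφc ω)) fun ω => (hFc ω).maximizers_nonempty (hFne ω) (hφc ω)
  refine ⟨h, hm, fun ω => (hh ω).1, fun ω =>
    (IsGreatest.csSup_eq (s := φ ω '' F ω) ⟨⟨_, (hh ω).1, rfl⟩, ?_⟩).symm⟩
  rintro _ ⟨x, hx, rfl⟩
  exact (hh ω).2 hx

end MeasurableMaximum

theorem measurable_norm_toEuclideanCLM {Ω : Type*} [MeasurableSpace Ω] {d : ℕ}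
    {W : Ω → Matrix (Fin d) (Fin d) ℂ} (hW : ∀ i j, Measurable fun ω => W ω i j)
    (v : EuclideanSpace ℂ (Fin d)) :
    Measurable fun ω => ‖Matrix.toEuclideanCLM (𝕜 := ℂ) (W ω) v‖ := by
  simp only [EuclideanSpace.norm_eq, Matrix.ofLp_toEuclideanCLM, Matrix.mulVec, dotProduct]
  fun_prop

theorem statement17 {Ω : Type*} [MeasurableSpace Ω] {d : ℕ} (μ : Measure Ω)
    (W : Ω → Matrix (Fin d) (Fin d) ℂ)
    (hWmeas : ∀ i j, Measurable fun ω => W ω i j)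
    (hWpos : ∀ ω, (W ω).PosDef)
    (F : Ω → Set (EuclideanSpace ℂ (Fin d)))
    (hFK : ∀ ω, KBCS (F ω)) (hF : WeaklyMeasurable F) :
    (∃ h : Ω → EuclideanSpace ℂ (Fin d), Measurable h ∧ (∀ ω, h ω ∈ F ω) ∧
      ∀ᵐ ω ∂μ, ‖Matrix.toEuclideanCLM (𝕜 := ℂ) (W ω) (h ω)‖ =
        sSup ((fun v => ‖Matrix.toEuclideanCLM (𝕜 := ℂ) (W ω) v‖) '' F ω)) ∧
    ∃ h : Ω → EuclideanSpace ℂ (Fin d), Measurable h ∧ (∀ ω, h ω ∈ F ω) ∧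
      ∀ᵐ ω ∂μ, ‖h ω‖ = sSup ((fun v => ‖v‖) '' F ω) := by
  have hFc (ω) : IsCompact (F ω) :=
    Metric.isCompact_of_isClosed_isBounded (hFK ω).2.2.1 (hFK ω).2.2.2.1
  have hFne (ω) : (F ω).Nonempty := (hFK ω).1
  obtain ⟨h, hm, hhF, hh⟩ := hF.exists_measurable_eq_sSup hFc hFne
    (measurable_norm_toEuclideanCLM hWmeas) fun ω => by fun_prop
  obtain ⟨g, gm, hgF, hg⟩ := hF.exists_measurable_eq_sSup hFc hFne
    (φ := fun _ v => ‖v‖) (fun _ => measurable_const) fun _ => continuous_norm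
  exact ⟨⟨h, hm, hhF, .of_forall hh⟩, g, gm, hgF, .of_forall hg⟩

end
end

section
/- Let t ∈ (1, ∞) and δ ∈ (0, 1). Set t' := t/(t−1), θ := t'·(1+δ), θ' := θ/(θ−1), q := t/θ' and q' := q/(q−1). Then q > 1, in fact q − 1 = δ(t−1)/(1+δ), and (q')^q ≤ e·(t+1)/(δ·(t−1)); in particular (q')^q ≤ C·δ^{-1} for a constant C depending only on t. -/
open MeasureTheory ENNReal
open scoped ComplexOrder Pointwise

noncomputable section


/-- The elementary bound `(1 + 1/s)^(1 + s) ≤ e (1 + 1/s)`, with `r = 1 + s` and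
`1 + 1/s` written as the conjugate exponent of `r`. -/
theorem conjExponent_rpow_le {r : ℝ} (hr : 1 < r) :
    (r / (r - 1)) ^ r ≤ Real.exp 1 * (r / (r - 1)) := by
  have hs : 0 < r - 1 := sub_pos.2 hr
  have hpos : 0 < r / (r - 1) := by positivity
  have hexp : r / (r - 1) ≤ Real.exp (1 / (r - 1)) := by
    have h := Real.add_one_le_exp (1 / (r - 1))
    have heq : r / (r - 1) = 1 / (r - 1) + 1 := by field_simp; ring
    rwa [heq]
  calc (r / (r - 1)) ^ r = (r / (r - 1)) ^ (r - 1) * (r / (r - 1)) := by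
        rw [← Real.rpow_add_one hpos.ne', sub_add_cancel]
    _ ≤ Real.exp (1 / (r - 1)) ^ (r - 1) * (r / (r - 1)) := by gcongr
    _ = Real.exp 1 * (r / (r - 1)) := by
        rw [← Real.exp_mul, one_div_mul_cancel hs.ne']

theorem statement18 (t : ℝ) (ht : 1 < t) :
    ∃ C : ℝ, 0 < C ∧
      ∀ δ t' θ θ' q q' : ℝ, 0 < δ → δ < 1 →
        t' = t / (t - 1) → θ = t' * (1 + δ) → θ' = θ / (θ - 1) →
        q = t / θ' → q' = q / (q - 1) →
        1 < q ∧ q - 1 = δ * (t - 1) / (1 + δ) ∧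
          q' ^ q ≤ Real.exp 1 * (t + 1) / (δ * (t - 1)) ∧ q' ^ q ≤ C / δ := by
  have ht1 : 0 < t - 1 := sub_pos.2 ht
  have ht0 : 0 < t := by linarith
  refine ⟨Real.exp 1 * (t + 1) / (t - 1), by positivity, ?_⟩
  rintro δ t' θ θ' q q' hδ hδ1 ht' hθ hθ' hq hq'
  have hδp : 0 < 1 + δ := by linarith
  have hθ_eq : θ = t * (1 + δ) / (t - 1) := by rw [hθ, ht']; ring
  have hq_sub : q - 1 = δ * (t - 1) / (1 + δ) := by
    rw [hq, hθ', div_div_eq_mul_div, mul_sub, hθ_eq]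
    field_simp
    ring
  have hq1 : 1 < q := by
    rw [← sub_pos, hq_sub]; positivity
  have hq'_le : q' ≤ (t + 1) / (δ * (t - 1)) := by
    have hq_eq : q = (1 + t * δ) / (1 + δ) := by
      rw [← sub_add_cancel q 1, hq_sub]; field_simp; ring
    rw [hq', hq_sub, hq_eq, div_div_div_cancel_right₀ hδp.ne']
    refine div_le_div_of_nonneg_right ?_ (by positivity)
    nlinarith
  have hbound : q' ^ q ≤ Real.exp 1 * (t + 1) / (δ * (t - 1)) :=
    calc q' ^ q ≤ Real.exp 1 * q' := by rw [hq']; exact conjExponent_rpow_le hq1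
      _ ≤ Real.exp 1 * ((t + 1) / (δ * (t - 1))) := by gcongr
      _ = Real.exp 1 * (t + 1) / (δ * (t - 1)) := by ring
  refine ⟨hq1, hq_sub, hbound, hbound.trans_eq ?_⟩
  rw [div_div, mul_comm δ]

end
end
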